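/- arXiv:2211.12919 — 2 statements merged into one kernel-verified Lean document; each statement's English description precedes it below -/
import Mathlib

section
/- Let D be a finite abelian group, n ≥ 1, and m ≥ 1. For d ≥ 1 let a_d denote the number of subgroups of index d in D. Then the number of subgroups of index m in D × ℤ^n equals Σ a_{d_1} · d_1 d_2 ⋯ d_n, where the sum is over all n-tuples (d_1, …, d_n) of positive integers satisfying d_1 ∣ d_2 ∣ ⋯ ∣ d_n ∣ m. -/
/-- The index of a subgroup of a product is the product of the indices of its projection to the
second factor and of its intersection with the first factor. -/
theorem Subgroup.index_eq_index_map_snd_mul_index_comap_inl {B C : Type*} [CommGroup B]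
    [CommGroup C] (H : Subgroup (B × C)) :
    H.index = (H.map (MonoidHom.snd B C)).index * (H.comap (MonoidHom.inl B C)).index := by
  have hker : (MonoidHom.snd B C).ker = (MonoidHom.inl B C).range := by
    ext ⟨b, c⟩
    simp [Subgroup.mem_prod, eq_comm (a := c)]
  have hrange : (MonoidHom.snd B C).range = ⊤ :=
    MonoidHom.range_eq_top.2 Prod.snd_surjective
  rw [Subgroup.index_map, Subgroup.index_comap, hrange, Subgroup.index_top, mul_one, hker,
    ← Subgroup.relIndex_sup_right, mul_comm, sup_comm _ H,
    Subgroup.relIndex_mul_index le_sup_left]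

/-- The subgroup of `B × ℤ` generated by `K ≤ B` and the element `(x, k)`. -/
def Subgroup.extendByInt {B : Type*} [CommGroup B] (K : Subgroup B) (x : B) (k : ℕ) :
    Subgroup (B × Multiplicative ℤ) :=
  K.map (MonoidHom.inl B (Multiplicative ℤ)) ⊔
    Subgroup.zpowers (x, Multiplicative.ofAdd (k : ℤ))

theorem Subgroup.mem_extendByInt {B : Type*} [CommGroup B] {K : Subgroup B} {x : B} {k : ℕ}
    {b : B} {z : ℤ} :
    (b, Multiplicative.ofAdd z) ∈ K.extendByInt x k ↔ ∃ j : ℤ, b * (x ^ j)⁻¹ ∈ K ∧ z = j * k := by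
  simp only [extendByInt, Subgroup.mem_sup, Subgroup.mem_map, Subgroup.mem_zpowers_iff]
  constructor
  · rintro ⟨_, ⟨c, hc, rfl⟩, _, ⟨j, rfl⟩, h⟩
    simp only [MonoidHom.inl_apply, Prod.pow_mk, Prod.mk_mul_mk, one_mul, Prod.mk.injEq] at h
    refine ⟨j, ?_, ?_⟩
    · rw [← h.1]
      simpa using hc
    · have h2 := congrArg Multiplicative.toAdd h.2
      simpa using h2.symm
  · rintro ⟨j, hj, rfl⟩
    refine ⟨_, ⟨_, hj, rfl⟩, _, ⟨j, rfl⟩, ?_⟩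
    simp only [MonoidHom.inl_apply, Prod.pow_mk, Prod.mk_mul_mk, one_mul, Prod.mk.injEq,
      inv_mul_cancel_right, true_and]
    rw [← ofAdd_zsmul, smul_eq_mul]

theorem Subgroup.comap_inl_extendByInt {B : Type*} [CommGroup B] (K : Subgroup B) (x : B) {k : ℕ}
    (hk : k ≠ 0) : (K.extendByInt x k).comap (MonoidHom.inl B (Multiplicative ℤ)) = K := by
  ext b
  rw [Subgroup.mem_comap, MonoidHom.inl_apply, ← ofAdd_zero, mem_extendByInt]
  constructor
  · rintro ⟨j, hj, h⟩
    obtain rfl : j = 0 := by simpa [hk] using h.symm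
    simpa using hj
  · intro hb
    exact ⟨0, by simpa using hb, by simp⟩

theorem Subgroup.index_zpowers_ofAdd (k : ℕ) :
    (Subgroup.zpowers (Multiplicative.ofAdd (k : ℤ))).index = k :=
  (Int.index_zmultiples (k : ℤ)).trans (Int.natAbs_natCast k)

theorem Subgroup.eq_zpowers_ofAdd_index (L : Subgroup (Multiplicative ℤ)) :
    L = Subgroup.zpowers (Multiplicative.ofAdd (L.index : ℤ)) := by
  obtain ⟨g, rfl⟩ := (Subgroup.isCyclic_iff_exists_zpowers_eq_top L).1 inferInstance
  obtain ⟨z, rfl⟩ := Multiplicative.ofAdd.surjective g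
  have hz : (Subgroup.zpowers (Multiplicative.ofAdd z)).index = z.natAbs := Int.index_zmultiples z
  rw [hz]
  rcases Int.natAbs_eq z with h | h
  · rw [← h]
  · rw [← Subgroup.zpowers_inv, ← ofAdd_neg]
    congr 2
    omega

theorem Subgroup.index_extendByInt {B : Type*} [CommGroup B] (K : Subgroup B) (x : B) {k : ℕ}
    (hk : k ≠ 0) : (K.extendByInt x k).index = k * K.index := by
  rw [index_eq_index_map_snd_mul_index_comap_inl, comap_inl_extendByInt K x hk]
  congr 1
  rw [extendByInt, Subgroup.map_sup, Subgroup.map_map, MonoidHom.snd_comp_inl,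
    MonoidHom.map_zpowers]
  simp [Subgroup.index_zpowers_ofAdd]

/-- Every subgroup of index `m` in `B × ℤ` is generated by a subgroup `K ≤ B` of index dividing
`m` and an element `(x, m / [B : K])`, where `x` is unique modulo `K`. -/
theorem Subgroup.exists_bijective_index_prod_int (B : Type*) [CommGroup B] {m : ℕ} (hm : m ≠ 0) :
    ∃ f : (Σ K : {K : Subgroup B // K.index ∣ m}, B ⧸ K.1) →
      {H : Subgroup (B × Multiplicative ℤ) // H.index = m}, Function.Bijective f := by
  have hk (K : {K : Subgroup B // K.index ∣ m}) : m / K.1.index ≠ 0 :=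
    (Nat.div_pos (Nat.le_of_dvd (Nat.pos_of_ne_zero hm) K.2)
      (Nat.pos_of_dvd_of_pos K.2 (Nat.pos_of_ne_zero hm))).ne'
  refine ⟨fun p => ⟨p.1.1.extendByInt p.2.out (m / p.1.1.index), ?_⟩, ?_, ?_⟩
  · rw [index_extendByInt _ _ (hk p.1), Nat.div_mul_cancel p.1.2]
  · rintro ⟨K, x⟩ ⟨K', x'⟩ h
    have h := congrArg Subtype.val h
    dsimp only at h
    have hK : K = K' := by
      apply Subtype.ext
      rw [← comap_inl_extendByInt K.1 x.out (hk K), h, comap_inl_extendByInt _ _ (hk K')]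
    subst hK
    have hx : (x.out, Multiplicative.ofAdd ((m / K.1.index : ℕ) : ℤ)) ∈
        K.1.extendByInt x.out (m / K.1.index) := mem_extendByInt.2 ⟨1, by simp, by simp⟩
    rw [h, mem_extendByInt] at hx
    obtain ⟨j, hj, hj'⟩ := hx
    have hk0 : ((m / K.1.index : ℕ) : ℤ) ≠ 0 := Nat.cast_ne_zero.2 (hk K)
    obtain rfl : j = 1 := (mul_right_cancel₀ hk0 (by rw [one_mul]; exact hj')).symm
    have : x' = x := by
      rw [← Quotient.out_eq' x, ← Quotient.out_eq' x']
      refine QuotientGroup.eq.2 ?_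
      simpa [mul_comm] using hj
    rw [this]
  · rintro ⟨H, rfl⟩
    have hidx := H.index_eq_index_map_snd_mul_index_comap_inl
    set K := H.comap (MonoidHom.inl B (Multiplicative ℤ)) with hKdef
    set L := H.map (MonoidHom.snd B (Multiplicative ℤ)) with hLdef
    have hK : K.index ∣ H.index := Dvd.intro_left _ hidx.symm
    have hKpos : 0 < K.index := Nat.pos_of_dvd_of_pos hK (Nat.pos_of_ne_zero hm)
    have hdiv : H.index / K.index = L.index := by rw [hidx, Nat.mul_div_cancel _ hKpos]
    have hL := eq_zpowers_ofAdd_index L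
    have hmem : Multiplicative.ofAdd (L.index : ℤ) ∈ L :=
      hL.ge (Subgroup.mem_zpowers _)
    obtain ⟨⟨x, w⟩, hxH, hw⟩ := hmem
    obtain rfl : w = Multiplicative.ofAdd (L.index : ℤ) := hw
    refine ⟨⟨⟨K, hK⟩, (x : B ⧸ K)⟩, Subtype.ext ?_⟩
    dsimp only
    rw [hdiv]
    set y := (x : B ⧸ K).out with hy
    have hyK : x⁻¹ * y ∈ K := QuotientGroup.eq.1 (Quotient.out_eq' (x : B ⧸ K)).symm
    have hyH : (y, Multiplicative.ofAdd (L.index : ℤ)) ∈ H := by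
      simpa using H.mul_mem hxH (Subgroup.mem_comap.1 hyK)
    ext ⟨b, w⟩
    obtain ⟨z, rfl⟩ := Multiplicative.ofAdd.surjective w
    have key (j : ℤ) : b * (y ^ j)⁻¹ ∈ K ↔ (b, Multiplicative.ofAdd (j * L.index : ℤ)) ∈ H := by
      rw [hKdef, Subgroup.mem_comap, ← H.mul_mem_cancel_right (H.zpow_mem hyH j),
        MonoidHom.inl_apply, Prod.pow_mk, Prod.mk_mul_mk, inv_mul_cancel_right, one_mul,
        ← ofAdd_zsmul, smul_eq_mul]
    rw [mem_extendByInt]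
    constructor
    · rintro ⟨j, hj, rfl⟩
      exact (key j).1 hj
    · intro hb
      have hz : Multiplicative.ofAdd z ∈ L := ⟨_, hb, rfl⟩
      rw [hL] at hz
      obtain ⟨j, hj⟩ := Subgroup.mem_zpowers_iff.1 hz
      obtain rfl : j * L.index = z := by
        rw [← ofAdd_zsmul, smul_eq_mul] at hj
        exact Multiplicative.ofAdd.injective hj
      exact ⟨j, (key j).2 hb, rfl⟩

theorem Subgroup.finite_and_card_index_prod_int (B : Type*) [CommGroup B]
    (hB : ∀ d ≠ 0, Finite {K : Subgroup B // K.index = d}) {m : ℕ} (hm : m ≠ 0) :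
    Finite {H : Subgroup (B × Multiplicative ℤ) // H.index = m} ∧
      Nat.card {H : Subgroup (B × Multiplicative ℤ) // H.index = m} =
        ∑ d ∈ m.divisors, Nat.card {K : Subgroup B // K.index = d} * d := by
  classical
  obtain ⟨f, hf⟩ := exists_bijective_index_prod_int B hm
  have hfin : Finite {K : Subgroup B // K.index ∣ m} := by
    have : {K : Subgroup B | K.index ∣ m} =
        ⋃ d ∈ m.divisors, {K : Subgroup B | K.index = d} := by
      ext K
      simp [hm]
    refine Set.Finite.to_subtype (s := {K : Subgroup B | K.index ∣ m}) ?_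
    rw [this]
    exact m.divisors.finite_toSet.biUnion fun d hd =>
      Set.finite_coe_iff.1 (hB d (Nat.pos_of_mem_divisors hd).ne')
  have hquot (K : {K : Subgroup B // K.index ∣ m}) : Finite (B ⧸ K.1) :=
    have : K.1.FiniteIndex := ⟨ne_zero_of_dvd_ne_zero hm K.2⟩
    Subgroup.finite_quotient_of_finiteIndex
  have := Fintype.ofFinite {K : Subgroup B // K.index ∣ m}
  refine ⟨Finite.of_surjective f hf.2, ?_⟩
  rw [← Nat.card_congr (Equiv.ofBijective f hf), Nat.card_sigma,
    ← Finset.sum_fiberwise_of_maps_to (t := m.divisors) (g := fun K => K.1.index)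
      fun K _ => Nat.mem_divisors.2 ⟨K.2, hm⟩]
  refine Finset.sum_congr rfl fun d hd => ?_
  have hcard : Nat.card {K : Subgroup B // K.index = d} =
      (Finset.univ.filter fun K : {K : Subgroup B // K.index ∣ m} => K.1.index = d).card := by
    rw [← Fintype.card_subtype, ← Nat.card_eq_fintype_card]
    refine (Nat.card_congr (Equiv.subtypeSubtypeEquivSubtype ?_)).symm
    rintro K rfl
    exact Nat.dvd_of_mem_divisors hd
  rw [hcard, ← smul_eq_mul]
  refine Finset.sum_const_nat ?_
  intro K hK
  exact (Finset.mem_filter.1 hK).2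

/-- Isomorphic groups have equivalent collections of subgroups of a given index. -/
def MulEquiv.subgroupIndexEquiv {G G' : Type*} [Group G] [Group G'] (e : G ≃* G') (m : ℕ) :
    {H : Subgroup G // H.index = m} ≃ {H : Subgroup G' // H.index = m} :=
  e.mapSubgroup.toEquiv.subtypeEquiv fun H => by
    simp [Subgroup.index_map_equiv]

/-- Splitting off the last coordinate of `D × A ^ (n + 1)`. -/
def MulEquiv.prodFinSucc (D A : Type*) [Group D] [Group A] (n : ℕ) :
    (D × (Fin n → A)) × A ≃* D × (Fin (n + 1) → A) where
  toFun p := (p.1.1, Fin.snoc p.1.2 p.2)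
  invFun q := ((q.1, Fin.init q.2), q.2 (Fin.last n))
  left_inv p := by simp
  right_inv q := by simp
  map_mul' p q := by
    refine Prod.ext rfl (funext fun i => ?_)
    refine Fin.lastCases ?_ (fun j => ?_) i <;> simp

theorem Subgroup.finite_index_eq_prod_int_pow (D : Type*) [CommGroup D] [Finite D] (n : ℕ) :
    ∀ d ≠ 0, Finite {K : Subgroup (D × (Fin n → Multiplicative ℤ)) // K.index = d} := by
  induction n with
  | zero =>
    intro d _
    infer_instance
  | succ n ih =>
    intro d hd
    have := (finite_and_card_index_prod_int _ ih hd).1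
    exact Finite.of_equiv _ ((MulEquiv.prodFinSucc D (Multiplicative ℤ) n).subgroupIndexEquiv d)

theorem Subgroup.card_index_prod_int_pow_succ (D : Type*) [CommGroup D] [Finite D] (n : ℕ) {m : ℕ}
    (hm : m ≠ 0) :
    Nat.card {H : Subgroup (D × (Fin (n + 1) → Multiplicative ℤ)) // H.index = m} =
      ∑ d ∈ m.divisors,
        Nat.card {K : Subgroup (D × (Fin n → Multiplicative ℤ)) // K.index = d} * d := by
  rw [← (finite_and_card_index_prod_int _ (finite_index_eq_prod_int_pow D n) hm).2]
  exact (Nat.card_congr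
    ((MulEquiv.prodFinSucc D (Multiplicative ℤ) n).subgroupIndexEquiv m)).symm

/-- The tuples `d` of divisors of `m` with `d 0 ∣ d 1 ∣ ⋯`. -/
def Nat.divisorChains (n m : ℕ) : Finset (Fin n → ℕ) :=
  (Fintype.piFinset fun _ : Fin n => m.divisors).filter
    (fun d => ∀ (i : Fin n) (h : (i : ℕ) + 1 < n), d i ∣ d ⟨(i : ℕ) + 1, h⟩)

theorem Nat.mem_divisorChains {n m : ℕ} {d : Fin n → ℕ} :
    d ∈ divisorChains n m ↔ (∀ i, d i ∈ m.divisors) ∧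
      ∀ (i : Fin n) (h : (i : ℕ) + 1 < n), d i ∣ d ⟨(i : ℕ) + 1, h⟩ := by
  simp only [divisorChains, Finset.mem_filter, Fintype.mem_piFinset]

theorem Nat.dvd_last_of_mem_divisorChains {n m : ℕ} {d : Fin (n + 1) → ℕ}
    (hd : d ∈ divisorChains (n + 1) m) (i : Fin (n + 1)) : d i ∣ d (Fin.last n) := by
  induction i using Fin.reverseInduction with
  | last => exact dvd_rfl
  | cast i ih => exact ((mem_divisorChains.1 hd).2 i.castSucc (by simp)).trans ih

theorem Nat.sum_divisorChains_succ {n m : ℕ} (hm : m ≠ 0) (f : (Fin (n + 2) → ℕ) → ℕ) :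
    ∑ d ∈ divisorChains (n + 2) m, f d =
      ∑ e ∈ m.divisors, ∑ d ∈ divisorChains (n + 1) e, f (Fin.snoc d e) := by
  rw [Finset.sum_sigma']
  refine Finset.sum_bij' (fun d _ => ⟨d (Fin.last _), Fin.init d⟩)
    (fun p _ => Fin.snoc p.2 p.1) ?_ ?_ ?_ ?_ ?_
  · intro d hd
    have hd' := mem_divisorChains.1 hd
    refine Finset.mem_sigma.2 ⟨hd'.1 _, mem_divisorChains.2 ⟨fun i => ?_, fun i h => ?_⟩⟩
    · exact Nat.mem_divisors.2 ⟨dvd_last_of_mem_divisorChains hd _,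
        (Nat.pos_of_mem_divisors (hd'.1 _)).ne'⟩
    · exact hd'.2 i.castSucc (Nat.lt_succ_of_lt h)
  · rintro ⟨e, d⟩ hp
    obtain ⟨he, hd⟩ := Finset.mem_sigma.1 hp
    have hd' := mem_divisorChains.1 hd
    dsimp only at he hd hd' ⊢
    refine mem_divisorChains.2 ⟨fun i => ?_, fun i h => ?_⟩
    · induction i using Fin.lastCases with
      | last => simpa using he
      | cast i =>
        rw [Fin.snoc_castSucc]
        exact Nat.mem_divisors.2 ⟨(Nat.dvd_of_mem_divisors (hd'.1 i)).trans
          (Nat.dvd_of_mem_divisors he), hm⟩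
    · induction i using Fin.lastCases with
      | last => simp at h
      | cast i =>
        rw [Fin.snoc_castSucc]
        have hs : (⟨(i.castSucc : ℕ) + 1, h⟩ : Fin (n + 2)) = i.succ := rfl
        rw [hs]
        induction i using Fin.lastCases with
        | last =>
          rw [Fin.succ_last, Fin.snoc_last]
          exact Nat.dvd_of_mem_divisors (hd'.1 _)
        | cast i =>
          rw [Fin.succ_castSucc, Fin.snoc_castSucc]
          exact hd'.2 i.castSucc (by simp)
  · intro d _
    simp
  · rintro ⟨e, d⟩ _
    simp
  · intro d _
    simp

theorem Subgroup.card_index_prod_int_pow (D : Type*) [CommGroup D] [Finite D] (n : ℕ) :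
    ∀ m ≠ 0, Nat.card {H : Subgroup (D × (Fin (n + 1) → Multiplicative ℤ)) // H.index = m} =
      ∑ d ∈ Nat.divisorChains (n + 1) m,
        Nat.card {H : Subgroup D // H.index = d 0} * ∏ i, d i := by
  induction n with
  | zero =>
    intro m hm
    rw [card_index_prod_int_pow_succ D 0 hm]
    refine Finset.sum_bij' (fun e _ _ => e) (fun d _ => d 0) ?_ ?_ ?_ ?_ ?_
    · intro e he
      exact Nat.mem_divisorChains.2 ⟨fun _ => he, fun i h => by omega⟩
    · intro d hd
      exact (Nat.mem_divisorChains.1 hd).1 0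
    · intro e _
      rfl
    · intro d _
      exact funext fun i => congrArg d (Fin.fin_one_eq_zero i).symm
    · intro e _
      rw [Nat.card_congr ((MulEquiv.prodUnique (M := D)
        (N := Fin 0 → Multiplicative ℤ)).subgroupIndexEquiv e)]
      simp
  | succ n ih =>
    intro m hm
    rw [card_index_prod_int_pow_succ D (n + 1) hm, Nat.sum_divisorChains_succ hm]
    refine Finset.sum_congr rfl fun e he => ?_
    rw [ih e (Nat.pos_of_mem_divisors he).ne', Finset.sum_mul]
    refine Finset.sum_congr rfl fun d _ => ?_
    have h0 : (Fin.snoc d e : Fin (n + 2) → ℕ) 0 = d 0 :=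
      Fin.snoc_castSucc (α := fun _ => ℕ) e d 0
    rw [Fin.prod_univ_castSucc (n := n + 1), h0, mul_assoc]
    simp only [Fin.snoc_castSucc, Fin.snoc_last]

theorem stmt_15 {D : Type*} [CommGroup D] [Finite D] (n m : ℕ) (hn : 1 ≤ n) (hm : 1 ≤ m) :
    Nat.card {H : Subgroup (D × (Fin n → Multiplicative ℤ)) // H.index = m} =
      ∑ d ∈ (Fintype.piFinset fun _ : Fin n => m.divisors).filter
          (fun d => ∀ (i : Fin n) (h : (i : ℕ) + 1 < n), d i ∣ d ⟨(i : ℕ) + 1, h⟩),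
        Nat.card {H : Subgroup D // H.index = d ⟨0, by omega⟩} * ∏ i, d i := by
  obtain ⟨n, rfl⟩ := Nat.exists_eq_add_of_le' hn
  exact Subgroup.card_index_prod_int_pow D n m (Nat.one_le_iff_ne_zero.1 hm)
end

section
/- Let n ≥ 1 and m ≥ 1. The number of orbits of the simultaneous conjugation action of the symmetric group S_n on the set (S_n)^m of m-tuples of permutations, given by μ • (σ_1, …, σ_m) = (μσ_1μ^{-1}, …, μσ_mμ^{-1}), equals the sum over all (m+1)-tuples (V_1, …, V_m, W) of isomorphism classes of irreducible finite-dimensional complex representations of S_n of the squares of the multiplicities dim_ℂ Hom_{S_n}(V_1 ⊗ ⋯ ⊗ V_m, W), where V_1 ⊗ ⋯ ⊗ V_m carries the diagonal S_n-action. -/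
open CategoryTheory MonoidalCategory

section

open scoped MonoidAlgebra

variable {k G : Type*} [Field k] [Group G]

theorem MonoidAlgebra.sum_single_mem_center [Fintype G] {f : G → k}
    (hf : ∀ g h, f (h * g * h⁻¹) = f g) :
    ∑ g, MonoidAlgebra.single g (f g) ∈ Submonoid.center k[G] := by
  rw [Submonoid.mem_center_iff]
  intro y
  induction y using MonoidAlgebra.induction_on with
  | of h =>
    simp only [MonoidAlgebra.of_apply, Finset.mul_sum, Finset.sum_mul,
      MonoidAlgebra.single_mul_single, one_mul, mul_one]
    refine Fintype.sum_equiv (MulAut.conj h).toEquiv _ _ fun g => ?_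
    simp [hf]
  | add x y hx hy => rw [add_mul, mul_add, hx, hy]
  | smul r x hx => rw [smul_mul_assoc, mul_smul_comm, hx]

theorem Representation.asAlgebraHom_eq_zero_of_sum_mul_character_eq_zero
    [Fintype G] [IsAlgClosed k] [CharZero k] {V : Type*} [AddCommGroup V] [Module k V]
    [FiniteDimensional k V] (ρ : Representation k G V) [ρ.IsIrreducible] {f : G → k}
    (hf : ∀ g h, f (h * g * h⁻¹) = f g) (h : ∑ g, f g * ρ.character g = 0) :
    ρ.asAlgebraHom (∑ g, MonoidAlgebra.single g (f g)) = 0 := by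
  obtain ⟨c, hc⟩ :=
    (Representation.IsIrreducible.algebraMap_intertwiningMap_bijective_of_isAlgClosed
    (ρ := ρ)).2 (.centralAlgebraMul ρ (MonoidAlgebra.sum_single_mem_center hf))
  have hz : ρ.asAlgebraHom (∑ g, MonoidAlgebra.single g (f g)) = c • LinearMap.id := by
    ext v
    simpa using (congrArg (fun T => T v) hc).symm
  have ht : LinearMap.trace k V (ρ.asAlgebraHom (∑ g, MonoidAlgebra.single g (f g))) = 0 := by
    simpa [Representation.character] using h
  have : Nontrivial V := by
    by_contra hV
    rw [not_nontrivial_iff_subsingleton] at hV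
    exact bot_ne_top (α := Subrepresentation ρ)
      (Subrepresentation.toSubmodule_injective (Subsingleton.elim _ _))
  rw [hz, map_smul, LinearMap.trace_id, smul_eq_mul, mul_eq_zero, Nat.cast_eq_zero] at ht
  rw [hz, ht.resolve_right Module.finrank_pos.ne', zero_smul]

theorem Representation.asAlgebraHom_ofModule' (M : Type*) [AddCommGroup M] [Module k M]
    [Module k[G] M] [IsScalarTower k k[G] M] (z : k[G]) (x : M) :
    (Representation.ofModule' (k := k) (G := G) M).asAlgebraHom z x = z • x := by
  simp [Representation.asAlgebraHom_def, Representation.ofModule']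

theorem Representation.isIrreducible_ofModule' (M : Type*) [AddCommGroup M] [Module k M]
    [Module k[G] M] [IsScalarTower k k[G] M] [IsSimpleModule k[G] M] :
    (Representation.ofModule' (k := k) (G := G) M).IsIrreducible := by
  rw [Representation.irreducible_iff_isSimpleModule_asModule]
  let e : (Representation.ofModule' (k := k) (G := G) M).asModule ≃ₗ[k[G]] M :=
    { (Representation.ofModule' (k := k) (G := G) M).asModuleEquiv.toAddEquiv with
      map_smul' := fun z x => by
        simp [Representation.asModuleEquiv_map_smul, Representation.asAlgebraHom_ofModule'] }
  exact IsSimpleModule.congr e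

end

namespace FDRep

theorem character_foldr_tensorObj {k G : Type} [Field k] [Group G]
    (l : List (FDRep k G)) (g : G) :
    (l.foldr (fun A B => MonoidalCategoryStruct.tensorObj A B) (𝟙_ (FDRep k G))).character g =
      (l.map fun V => V.character g).prod := by
  induction l with
  | nil =>
    have h : (𝟙_ (FDRep k G)).ρ g = LinearMap.id := rfl
    rw [List.foldr_nil, character, h]
    exact (LinearMap.trace_id k k).trans (by simp)
  | cons V l ih => simp [ih]

open scoped MonoidAlgebra

variable {k G : Type} [Field k] [IsAlgClosed k] [CharZero k] [Group G] [Fintype G]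

theorem simple_of_isIrreducible {V : Type} [AddCommGroup V] [Module k V]
    [FiniteDimensional k V] (ρ : Representation k G V) [ρ.IsIrreducible] : Simple (FDRep.of ρ) := by
  have := invertibleOfNonzero (NeZero.ne (Nat.card G : k))
  rw [simple_iff_char_is_norm_one]
  have h := Representation.char_orthonormal ρ ρ
  rw [if_pos ⟨.refl ρ⟩, inv_mul_eq_one₀ (NeZero.ne _)] at h
  exact h.symm

theorem eq_zero_of_sum_mul_character_eq_zero {f : G → k} (hf : ∀ g h, f (h * g * h⁻¹) = f g)
    (h : ∀ V : FDRep k G, Simple V → ∑ g, f g * V.character g = 0) : f = 0 := by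
  set z : k[G] := ∑ g, MonoidAlgebra.single g (f g) with hz
  have hz0 : z ∈ Module.annihilator k[G] k[G] := by
    rw [← Submodule.annihilator_top, ← IsSemisimpleModule.sSup_simples_eq_top, sSup_eq_iSup',
      Submodule.annihilator_iSup, Submodule.mem_iInf]
    rintro ⟨S, hS⟩
    have : IsSimpleModule k[G] S := hS
    have : FiniteDimensional k k[G] := .of_basis (MonoidAlgebra.basis G k)
    have : FiniteDimensional k S :=
      inferInstanceAs (FiniteDimensional k (S.restrictScalars k))
    let ρ := Representation.ofModule' (k := k) (G := G) S
    have : ρ.IsIrreducible := Representation.isIrreducible_ofModule' S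
    have h0 := Representation.asAlgebraHom_eq_zero_of_sum_mul_character_eq_zero ρ hf
      (h _ (simple_of_isIrreducible ρ))
    refine Module.mem_annihilator.2 fun s => ?_
    rw [← Representation.asAlgebraHom_ofModule', hz, h0, LinearMap.zero_apply]
  have hz1 : z = 0 := by simpa using Module.mem_annihilator.1 hz0 1
  ext g
  classical
  simpa [hz, Finsupp.single_apply] using congrArg (fun y => y.coeff g) hz1

open scoped Classical in
theorem sum_character_mul_character_inv {ι : Type} [Fintype ι] (W : ι → FDRep k G)
    (hsimple : ∀ i, Simple (W i)) (hdistinct : ∀ i j, Nonempty (W i ≅ W j) → i = j)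
    (hcomplete : ∀ V : FDRep k G, Simple V → ∃ i, Nonempty (V ≅ W i)) (h g : G) :
    ∑ i, (W i).character h * (W i).character g⁻¹ =
      (Finset.univ.filter fun x : G => x * h * x⁻¹ = g).card := by
  have := invertibleOfNonzero (NeZero.ne (Nat.card G : k))
  refine sub_eq_zero.1 (congrFun (eq_zero_of_sum_mul_character_eq_zero (k := k)
    (f := fun g : G => ∑ i, (W i).character h * (W i).character g⁻¹ -
      ((Finset.univ.filter fun x : G => x * h * x⁻¹ = g).card : k)) ?_ ?_) g)
  · intro a b
    have hinv : (b * a * b⁻¹)⁻¹ = b * a⁻¹ * b⁻¹ := by group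
    simp only [hinv, char_conj]
    congr 2
    refine Finset.card_equiv (Equiv.mulLeft b⁻¹) fun x => ?_
    simp only [Finset.mem_filter_univ, Equiv.coe_mulLeft, mul_inv_rev, inv_inv]
    rw [← mul_left_inj b, ← mul_right_inj b⁻¹]
    simp [mul_assoc]
  · intro V hV
    obtain ⟨j, ⟨e⟩⟩ := hcomplete V hV
    rw [char_iso e]
    have horth (i : ι) : ∑ g, (W j).character g * (W i).character g⁻¹ =
        if i = j then (Nat.card G : k) else 0 := by
      have := hsimple i
      have := hsimple j
      have h := char_orthonormal (W j) (W i)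
      rw [inv_mul_eq_iff_eq_mul₀ (NeZero.ne _)] at h
      rw [h]
      by_cases hij : i = j
      · subst hij
        rw [if_pos ⟨Iso.refl _⟩, if_pos rfl, mul_one]
      · rw [if_neg fun ⟨e⟩ => hij (hdistinct _ _ ⟨e.symm⟩), if_neg hij, mul_zero]
    simp only [sub_mul, Finset.sum_sub_distrib, Finset.sum_mul, Finset.card_filter, Nat.cast_sum,
      Nat.cast_ite, Nat.cast_one, Nat.cast_zero, ite_mul, one_mul, zero_mul]
    rw [Finset.sum_comm (α := ι), Finset.sum_comm (γ := G) (α := G)]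
    have (i : ι) : ∑ x, (W i).character h * (W i).character x⁻¹ * (W j).character x =
        (W i).character h * if i = j then (Nat.card G : k) else 0 := by
      rw [← horth, Finset.mul_sum]
      exact Finset.sum_congr rfl fun x _ => by ring
    simp only [this]
    simp [mul_comm]

theorem sum_finrank_hom_sq {ι : Type} [Fintype ι] (W : ι → FDRep k G)
    (hsimple : ∀ i, Simple (W i)) (hdistinct : ∀ i j, Nonempty (W i ≅ W j) → i = j)
    (hcomplete : ∀ V : FDRep k G, Simple V → ∃ i, Nonempty (V ≅ W i)) (V : FDRep k G) :
    ∑ i, (Module.finrank k (V ⟶ W i) : k) ^ 2 =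
      (Nat.card G : k)⁻¹ * ∑ g, V.character g * V.character g⁻¹ := by
  classical
  have := invertibleOfNonzero (NeZero.ne (Nat.card G : k))
  have hcard : (Nat.card G : k) ≠ 0 := NeZero.ne _
  have hinv (i : ι) : (Module.finrank k (V ⟶ W i) : k) =
      (Nat.card G : k)⁻¹ * ∑ g, (W i).character g⁻¹ * V.character g := by
    rw [← scalar_product_char_eq_finrank_equivariant]
    congr 1
    exact Fintype.sum_equiv (Equiv.inv G) _ _ fun g => by simp
  have hsq (i : ι) : (Module.finrank k (V ⟶ W i) : k) ^ 2 =
      (Nat.card G : k)⁻¹ * (Nat.card G : k)⁻¹ * ∑ h, ∑ g, V.character h⁻¹ * V.character g *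
        ((W i).character h * (W i).character g⁻¹) := by
    rw [sq]
    nth_rw 1 [← scalar_product_char_eq_finrank_equivariant]
    rw [hinv, mul_mul_mul_comm, Finset.sum_mul_sum]
    congr 1
    exact Finset.sum_congr rfl fun h _ => Finset.sum_congr rfl fun g _ => by ring
  simp only [hsq, ← Finset.mul_sum]
  rw [Finset.sum_comm]
  simp only [Finset.sum_comm (γ := ι), ← Finset.mul_sum,
    sum_character_mul_character_inv W hsimple hdistinct hcomplete]
  have hconj (h : G) : ∑ g, V.character h⁻¹ * V.character g *
      ((Finset.univ.filter fun x : G => x * h * x⁻¹ = g).card : k) =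
        Nat.card G * (V.character h * V.character h⁻¹) := by
    simp only [Finset.card_filter, Nat.cast_sum, Nat.cast_ite, Nat.cast_one, Nat.cast_zero,
      Finset.mul_sum]
    rw [Finset.sum_comm]
    simp [mul_comm]
  simp only [hconj, ← Finset.mul_sum]
  field_simp

end FDRep

open scoped Classical in
theorem card_quot_simultaneous_conj {G : Type*} [Group G] [Fintype G] (m : ℕ) :
    Nat.card (Quot fun σ τ : Fin m → G => ∃ μ : G, (fun i => μ * σ i * μ⁻¹) = τ) * Nat.card G =
      ∑ g : G, (Finset.univ.filter fun x : G => x * g * x⁻¹ = g).card ^ m := by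
  have hquot : Nat.card (Quot fun σ τ : Fin m → G => ∃ μ : G, (fun i => μ * σ i * μ⁻¹) = τ) =
      Nat.card (MulAction.orbitRel.Quotient (ConjAct G) (Fin m → G)) := by
    refine Nat.card_congr (Quot.congrRight fun σ τ => ?_)
    rw [MulAction.orbitRel_apply, ← MulAction.mem_orbit_symm]
    exact ⟨fun ⟨μ, h⟩ => ⟨ConjAct.toConjAct μ, h⟩, fun ⟨μ, h⟩ => ⟨ConjAct.ofConjAct μ, h⟩⟩
  have hburnside :=
    MulAction.sum_card_fixedBy_eq_card_orbits_mul_card_group (ConjAct G) (Fin m → G)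
  rw [hquot, Nat.card_eq_fintype_card, Nat.card_eq_fintype_card, ← ConjAct.card (G := G)]
  refine hburnside.symm.trans ?_
  refine Fintype.sum_equiv ConjAct.ofConjAct.toEquiv _ _ fun g => ?_
  obtain ⟨g, rfl⟩ := ConjAct.toConjAct.surjective g
  rw [← Fintype.card_coe, ← Fintype.card_pi_const]
  refine Fintype.card_congr ((Equiv.subtypeEquivRight fun σ => ?_).trans
    (Equiv.subtypePiEquivPi (p := fun _ x => x ∈ Finset.univ.filter fun x : G => x * g * x⁻¹ = g)))
  simp only [MulAction.mem_fixedBy, funext_iff, Pi.smul_apply, ConjAct.toConjAct_smul,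
    Finset.mem_filter_univ, mul_inv_eq_iff_eq_mul]
  exact forall_congr' fun i => eq_comm

theorem stmt_19 (n m : ℕ) (hn : 1 ≤ n) (hm : 1 ≤ m)
    {ι : Type} [Fintype ι] (W : ι → FDRep ℂ (Equiv.Perm (Fin n)))
    (hsimple : ∀ i, Simple (W i))
    (hdistinct : ∀ i j, Nonempty (W i ≅ W j) → i = j)
    (hcomplete : ∀ V : FDRep ℂ (Equiv.Perm (Fin n)), Simple V → ∃ i, Nonempty (V ≅ W i)) :
    Nat.card (Quot fun σ τ : Fin m → Equiv.Perm (Fin n) =>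
        ∃ μ : Equiv.Perm (Fin n), (fun i => μ * σ i * μ⁻¹) = τ) =
      ∑ f : Fin m → ι, ∑ w : ι,
        Module.finrank ℂ
          (((List.ofFn fun j => W (f j)).foldr (fun A B => MonoidalCategoryStruct.tensorObj A B)
              (𝟙_ (FDRep ℂ (Equiv.Perm (Fin n))))) ⟶ W w) ^ 2 := by
  classical
  have hcard : (Nat.card (Equiv.Perm (Fin n)) : ℂ) ≠ 0 := NeZero.ne _
  have horbits := congrArg (Nat.cast (R := ℂ))
    (card_quot_simultaneous_conj (G := Equiv.Perm (Fin n)) m)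
  rw [Nat.cast_mul, ← eq_div_iff hcard] at horbits
  rw [← Nat.cast_inj (R := ℂ), horbits]
  push_cast
  simp only [FDRep.sum_finrank_hom_sq W hsimple hdistinct hcomplete,
    FDRep.character_foldr_tensorObj, List.map_ofFn, List.prod_ofFn, Function.comp_apply,
    ← Finset.prod_mul_distrib, ← Finset.mul_sum]
  rw [Finset.sum_comm, div_eq_inv_mul]
  congr 1
  refine Finset.sum_congr rfl fun g _ => ?_
  rw [← FDRep.sum_character_mul_character_inv W hsimple hdistinct hcomplete, Fintype.sum_pow]
end
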